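/- arXiv:2505.07026 — 4 statements merged into one kernel-verified Lean document; each statement's English description precedes it below -/
import Mathlib

section
/- Let E be a real inner product space, m a natural number, samples x : Fin m → E, labels y : Fin m → ℝ with y ℓ ∈ {-1, 1} for all ℓ, and a regularization parameter C > 0. Let A = {α : Fin m → ℝ | (∀ ℓ, 0 ≤ α ℓ ∧ α ℓ ≤ C) ∧ ∑ ℓ, α ℓ * y ℓ = 0} and f(α) = (∑ ℓ, α ℓ) − (1/2) * ‖∑ ℓ, α ℓ * y ℓ • x ℓ‖². Suppose α* ∈ A maximizes f over A, with support set S = {ℓ | α* ℓ > 0}, and let F ⊆ Fin m satisfy F ∩ S = ∅. Then the supremum of f over A ∩ {α | ∀ ℓ ∈ F, α ℓ = 0} equals the supremum of f over A, i.e., sSup (f '' (A ∩ {α | ∀ ℓ ∈ F, α ℓ = 0})) = sSup (f '' A). -/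
/-- If `αs` maximizes the dual soft-margin SVM objective `f` over the feasible set `A`,
with support vectors `S = {ℓ | 0 < αs ℓ}`, then for any `F` disjoint from `S`,
the supremum of `f` over the restricted feasible set `A ∩ {α | ∀ ℓ ∈ F, α ℓ = 0}`
equals the supremum of `f` over `A`. -/
theorem svm_sSup_restricted_eq_sSup
    {E : Type*} [NormedAddCommGroup E] [InnerProductSpace ℝ E]
    {m : ℕ} (x : Fin m → E) (y : Fin m → ℝ)
    (hy : ∀ ℓ, y ℓ = -1 ∨ y ℓ = 1)
    {C : ℝ} (hC : 0 < C)
    (A : Set (Fin m → ℝ))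
    (hA : A = {α : Fin m → ℝ | (∀ ℓ, 0 ≤ α ℓ ∧ α ℓ ≤ C) ∧ ∑ ℓ, α ℓ * y ℓ = 0})
    (f : (Fin m → ℝ) → ℝ)
    (hf : f = fun α => (∑ ℓ, α ℓ) - (1 / 2) * ‖∑ ℓ, (α ℓ * y ℓ) • x ℓ‖ ^ 2)
    (αs : Fin m → ℝ) (hαs : αs ∈ A)
    (hmax : ∀ α ∈ A, f α ≤ f αs)
    (S : Set (Fin m)) (hS : S = {ℓ | 0 < αs ℓ})
    (F : Set (Fin m)) (hF : F ∩ S = ∅) :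
    sSup (f '' (A ∩ {α | ∀ ℓ ∈ F, α ℓ = 0})) = sSup (f '' A) := by
  have hzero : ∀ ℓ ∈ F, αs ℓ = 0 := by
    intro ℓ hℓ
    have hnot : ¬ 0 < αs ℓ := fun hpos => by
      have hmem : ℓ ∈ F ∩ S := ⟨hℓ, by rw [hS]; exact hpos⟩
      rw [hF] at hmem
      exact hmem
    rw [hA] at hαs
    exact le_antisymm (not_lt.mp hnot) (hαs.1 ℓ).1
  have hfull : IsGreatest (f '' A) (f αs) :=
    ⟨Set.mem_image_of_mem f hαs, Set.forall_mem_image.mpr hmax⟩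
  have hrestr : IsGreatest (f '' (A ∩ {α | ∀ ℓ ∈ F, α ℓ = 0})) (f αs) :=
    ⟨Set.mem_image_of_mem f ⟨hαs, hzero⟩, Set.forall_mem_image.mpr fun α hα => hmax α hα.1⟩
  rw [hrestr.csSup_eq, hfull.csSup_eq]
end

section
/- Let E be a real inner product space, m, k natural numbers, samples x : Fin m → E, labels y : Fin m → ℝ with y ℓ ∈ {-1, 1} for all ℓ, and a regularization parameter C > 0. Let A = {α : Fin m → ℝ | (∀ ℓ, 0 ≤ α ℓ ∧ α ℓ ≤ C) ∧ ∑ ℓ, α ℓ * y ℓ = 0} and f(α) = (∑ ℓ, α ℓ) − (1/2) * ‖∑ ℓ, α ℓ * y ℓ • x ℓ‖². Suppose α* ∈ A maximizes f over A, with support set S = {ℓ | α* ℓ > 0}. Let F ⊆ Fin m satisfy F ∩ S = ∅ and let σ : Fin k → Fin m be an injection whose range is the complement of F. Then β* = α* ∘ σ is a maximizer of the subsample dual problem: 0 ≤ β* j ≤ C for all j, ∑ j, β* j * y (σ j) = 0, and g(β) ≤ g(β*) for every β : Fin k → ℝ with 0 ≤ β j ≤ C for all j and ∑ j, β j * y (σ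 j) = 0, where g(β) = (∑ j, β j) − (1/2) * ‖∑ j, β j * y (σ j) • x (σ j)‖². -/
/-- If `αs` maximizes the dual soft-margin SVM over the full dataset and the removed
set `F` contains no support vectors, then the restriction `αs ∘ σ` is a maximizer of
the subsample dual problem. -/
theorem svm_restriction_maximizes_subsample_problem
    {E : Type*} [NormedAddCommGroup E] [InnerProductSpace ℝ E]
    {m k : ℕ} (x : Fin m → E) (y : Fin m → ℝ)
    (hy : ∀ ℓ, y ℓ = -1 ∨ y ℓ = 1)
    {C : ℝ} (hC : 0 < C)
    (A : Set (Fin m → ℝ))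
    (hA : A = {α : Fin m → ℝ | (∀ ℓ, 0 ≤ α ℓ ∧ α ℓ ≤ C) ∧ ∑ ℓ, α ℓ * y ℓ = 0})
    (f : (Fin m → ℝ) → ℝ)
    (hf : f = fun α => (∑ ℓ, α ℓ) - (1 / 2) * ‖∑ ℓ, (α ℓ * y ℓ) • x ℓ‖ ^ 2)
    (αs : Fin m → ℝ) (hαs : αs ∈ A)
    (hmax : ∀ α ∈ A, f α ≤ f αs)
    (S : Set (Fin m)) (hS : S = {ℓ | 0 < αs ℓ})
    (F : Set (Fin m)) (hF : F ∩ S = ∅)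
    (σ : Fin k → Fin m)
    (hσinj : Function.Injective σ) (hσrange : Set.range σ = Fᶜ)
    (g : (Fin k → ℝ) → ℝ)
    (hg : g = fun β => (∑ j, β j) - (1 / 2) * ‖∑ j, (β j * y (σ j)) • x (σ j)‖ ^ 2) :
    (∀ j, 0 ≤ (αs ∘ σ) j ∧ (αs ∘ σ) j ≤ C) ∧ (∑ j, (αs ∘ σ) j * y (σ j) = 0) ∧
      ∀ β : Fin k → ℝ, (∀ j, 0 ≤ β j ∧ β j ≤ C) → (∑ j, β j * y (σ j) = 0) →
        g β ≤ g (αs ∘ σ) := by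
  subst hA hf hS hg
  obtain ⟨hbox, hbal⟩ := hαs
  have hzero : ∀ ℓ ∉ Set.range σ, αs ℓ = 0 := by
    intro ℓ hℓ
    have hℓF : ℓ ∈ F := by simpa [hσrange] using hℓ
    have hnot : ¬ 0 < αs ℓ := fun hpos => by
      have hmem : ℓ ∈ F ∩ {ℓ | 0 < αs ℓ} := ⟨hℓF, hpos⟩
      simp [hF] at hmem
    exact le_antisymm (not_lt.mp hnot) (hbox ℓ).1
  have hsum : ∀ α : Fin m → ℝ, (∀ ℓ ∉ Set.range σ, α ℓ = 0) →
      ∑ j, α (σ j) = ∑ ℓ, α ℓ ∧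
      ∑ j, α (σ j) * y (σ j) = ∑ ℓ, α ℓ * y ℓ ∧
      ∑ j, (α (σ j) * y (σ j)) • x (σ j) = ∑ ℓ, (α ℓ * y ℓ) • x ℓ := by
    intro α hα
    refine ⟨?_, ?_, ?_⟩ <;>
      exact Fintype.sum_of_injective σ hσinj _ _ (fun ℓ hℓ => by simp [hα ℓ hℓ]) fun _ => rfl
  obtain ⟨hs₁, hs₂, hs₃⟩ := hsum αs hzero
  refine ⟨fun j => hbox (σ j), hs₂.trans hbal, fun β hβ hβbal => ?_⟩
  obtain ⟨he₁, he₂, he₃⟩ := hsum (Function.extend σ β 0) fun ℓ hℓ => by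
    rw [Function.extend_apply' _ _ _ hℓ, Pi.zero_apply]
  simp only [hσinj.extend_apply] at he₁ he₂ he₃
  have hle := hmax (Function.extend σ β 0) ⟨fun ℓ => ?_, he₂.symm.trans hβbal⟩
  · simpa only [Function.comp_apply, he₁, he₃, hs₁, hs₃] using hle
  · by_cases hℓ : ℓ ∈ Set.range σ
    · obtain ⟨j, rfl⟩ := hℓ
      simpa only [hσinj.extend_apply] using hβ j
    · rw [Function.extend_apply' _ _ _ hℓ]
      exact ⟨le_rfl, hC.le⟩
end

section
/- Let E be a real inner product space, m a natural number, samples x : Fin m → E, labels y : Fin m → ℝ with y ℓ ∈ {-1, 1} for all ℓ, and a regularization parameter C > 0. Let A = {α : Fin m → ℝ | (∀ ℓ, 0 ≤ α ℓ ∧ α ℓ ≤ C) ∧ ∑ ℓ, α ℓ * y ℓ = 0} and f(α) = (∑ ℓ, α ℓ) − (1/2) * ‖∑ ℓ, α ℓ * y ℓ • x ℓ‖². If α₁ ∈ A and α₂ ∈ A both maximize f over A (i.e., f(α) ≤ f(α₁) and f(α) ≤ f(α₂) for all α ∈ A), then the corresponding primal weight vectors coincide: ∑ ℓ, α₁ ℓ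 * y ℓ • x ℓ = ∑ ℓ, α₂ ℓ * y ℓ • x ℓ. -/
/-- Any two maximizers of the dual soft-margin SVM problem yield the same primal
weight vector `w(α) = ∑ ℓ, (α ℓ * y ℓ) • x ℓ`. -/
theorem svm_maximizers_same_weight_vector
    {E : Type*} [NormedAddCommGroup E] [InnerProductSpace ℝ E]
    {m : ℕ} (x : Fin m → E) (y : Fin m → ℝ)
    (hy : ∀ ℓ, y ℓ = -1 ∨ y ℓ = 1)
    {C : ℝ} (hC : 0 < C)
    (A : Set (Fin m → ℝ))
    (hA : A = {α : Fin m → ℝ | (∀ ℓ, 0 ≤ α ℓ ∧ α ℓ ≤ C) ∧ ∑ ℓ, α ℓ * y ℓ = 0})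
    (f : (Fin m → ℝ) → ℝ)
    (hf : f = fun α => (∑ ℓ, α ℓ) - (1 / 2) * ‖∑ ℓ, (α ℓ * y ℓ) • x ℓ‖ ^ 2)
    (α₁ α₂ : Fin m → ℝ) (hα₁ : α₁ ∈ A) (hα₂ : α₂ ∈ A)
    (hmax₁ : ∀ α ∈ A, f α ≤ f α₁)
    (hmax₂ : ∀ α ∈ A, f α ≤ f α₂) :
    ∑ ℓ, (α₁ ℓ * y ℓ) • x ℓ = ∑ ℓ, (α₂ ℓ * y ℓ) • x ℓ := by
  have hmid : (fun ℓ => (α₁ ℓ + α₂ ℓ) / 2) ∈ A := by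
    rw [hA] at hα₁ hα₂ ⊢
    refine ⟨fun ℓ => ?_, ?_⟩
    · have h₁ := hα₁.1 ℓ
      have h₂ := hα₂.1 ℓ
      constructor <;> linarith
    · calc ∑ ℓ, (α₁ ℓ + α₂ ℓ) / 2 * y ℓ
          = (∑ ℓ, α₁ ℓ * y ℓ + ∑ ℓ, α₂ ℓ * y ℓ) / 2 := by
            rw [← Finset.sum_add_distrib, Finset.sum_div]
            exact Finset.sum_congr rfl fun ℓ _ => by ring
        _ = 0 := by rw [hα₁.2, hα₂.2]; norm_num
  have hsum : ∑ ℓ, (α₁ ℓ + α₂ ℓ) / 2 = (∑ ℓ, α₁ ℓ + ∑ ℓ, α₂ ℓ) / 2 := by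
    rw [← Finset.sum_add_distrib, Finset.sum_div]
  have hweight : ∑ ℓ, ((α₁ ℓ + α₂ ℓ) / 2 * y ℓ) • x ℓ =
      (1 / 2 : ℝ) • (∑ ℓ, (α₁ ℓ * y ℓ) • x ℓ + ∑ ℓ, (α₂ ℓ * y ℓ) • x ℓ) := by
    rw [← Finset.sum_add_distrib, Finset.smul_sum]
    refine Finset.sum_congr rfl fun ℓ _ => ?_
    rw [← add_smul, smul_smul]
    congr 1
    ring
  have h₁ := hmax₁ _ hmid
  have h₂ := hmax₂ _ hmid
  simp only [hf, hsum, hweight, norm_smul, mul_pow, Real.norm_eq_abs, sq_abs] at h₁ h₂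
  have hpar := parallelogram_law_with_norm ℝ
    (∑ ℓ, (α₁ ℓ * y ℓ) • x ℓ) (∑ ℓ, (α₂ ℓ * y ℓ) • x ℓ)
  rw [← sub_eq_zero, ← norm_eq_zero, ← sq_eq_zero_iff]
  exact le_antisymm (by linarith) (sq_nonneg _)
end

section
/- Let E be a real inner product space, m, k natural numbers, samples x : Fin m → E, labels y : Fin m → ℝ with y ℓ ∈ {-1, 1} for all ℓ, and a regularization parameter C > 0. Let A = {α : Fin m → ℝ | (∀ ℓ, 0 ≤ α ℓ ∧ α ℓ ≤ C) ∧ ∑ ℓ, α ℓ * y ℓ = 0} and f(α) = (∑ ℓ, α ℓ) − (1/2) * ‖∑ ℓ, α ℓ * y ℓ • x ℓ‖². Suppose α* ∈ A maximizes f over A, with support set S = {ℓ | α* ℓ > 0}, let F ⊆ Fin m satisfy F ∩ S = ∅, and let σ : Fin k → Fin m be an injection whose range is the complement of F. Then for every maximizer β of the subsample dual problem (i.e., β : Fin k → ℝ with 0 ≤ β j ≤ C for all j, ∑ j, β j * y (σ j) = 0, and g(β') ≤ g(β) for every feasible β', where g(β) = (∑ j, β j) − (1/2) * ‖∑ j,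 β j * y (σ j) • x (σ j)‖²), the primal weight vector of the retrained SVM equals that of the original SVM: ∑ j, β j * y (σ j) • x (σ j) = ∑ ℓ, α* ℓ * y ℓ • x ℓ. -/
/-- Two maximizers of a concave quadratic `φ v - (1 / 2) * ‖W v‖ ^ 2` over a convex set have the
same image under `W`. -/
lemma eq_image_of_isMaxOn_sub_half_sq_norm {V E : Type*} [AddCommGroup V] [Module ℝ V]
    [NormedAddCommGroup E] [InnerProductSpace ℝ E] (φ : V →ₗ[ℝ] ℝ) (W : V →ₗ[ℝ] E)
    {s : Set V} (hs : Convex ℝ s) {u v : V} (hu : u ∈ s) (hv : v ∈ s)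
    (humax : IsMaxOn (fun z => φ z - (1 / 2) * ‖W z‖ ^ 2) s u)
    (hvmax : IsMaxOn (fun z => φ z - (1 / 2) * ‖W z‖ ^ 2) s v) : W u = W v := by
  have hmid : (1 / 2 : ℝ) • u + (1 / 2 : ℝ) • v ∈ s :=
    hs hu hv (by norm_num) (by norm_num) (by norm_num)
  have h₁ := isMaxOn_iff.1 humax _ hmid
  have h₂ := isMaxOn_iff.1 hvmax _ hmid
  have hpar := parallelogram_law_with_norm ℝ (W u) (W v)
  simp only [map_add, map_smul, ← smul_add, norm_smul, smul_eq_mul, Real.norm_eq_abs] at h₁ h₂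
  rw [abs_of_pos (by norm_num : (0 : ℝ) < 1 / 2)] at h₁ h₂
  have hsq : ‖W u - W v‖ ^ 2 = 0 := le_antisymm (by nlinarith) (sq_nonneg _)
  exact sub_eq_zero.1 (norm_eq_zero.1 (pow_eq_zero_iff two_ne_zero |>.1 hsq))

/-- The dual feasible set of a soft-margin support vector machine is convex. -/
lemma convex_dual_feasible {ι : Type*} [Fintype ι] (y : ι → ℝ) (C : ℝ) :
    Convex ℝ {α : ι → ℝ | (∀ i, 0 ≤ α i ∧ α i ≤ C) ∧ ∑ i, α i * y i = 0} := by
  have hbox : Convex ℝ {α : ι → ℝ | ∀ i, 0 ≤ α i ∧ α i ≤ C} := by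
    simpa [Set.pi, Set.mem_Icc] using
      convex_pi (𝕜 := ℝ) (s := Set.univ) (t := fun _ : ι => Set.Icc 0 C)
        fun i _ => convex_Icc (0 : ℝ) C
  refine hbox.inter ?_
  intro a ha b hb p q _ _ _
  have ha' : ∑ i, a i * y i = 0 := ha
  have hb' : ∑ i, b i * y i = 0 := hb
  change ∑ i, (p • a + q • b) i * y i = 0
  simp [add_mul, mul_assoc, Finset.sum_add_distrib, ← Finset.mul_sum, ha', hb']


/-- Retraining on the dataset with non-support-vector samples `F` removed yields the
same primal weight vector: any maximizer `β` of the subsample dual problem satisfies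
`∑ j, (β j * y (σ j)) • x (σ j) = ∑ ℓ, (αs ℓ * y ℓ) • x ℓ`. -/
theorem svm_retrained_weight_vector_eq_original
    {E : Type*} [NormedAddCommGroup E] [InnerProductSpace ℝ E]
    {m k : ℕ} (x : Fin m → E) (y : Fin m → ℝ)
    (hy : ∀ ℓ, y ℓ = -1 ∨ y ℓ = 1)
    {C : ℝ} (hC : 0 < C)
    (A : Set (Fin m → ℝ))
    (hA : A = {α : Fin m → ℝ | (∀ ℓ, 0 ≤ α ℓ ∧ α ℓ ≤ C) ∧ ∑ ℓ, α ℓ * y ℓ = 0})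
    (f : (Fin m → ℝ) → ℝ)
    (hf : f = fun α => (∑ ℓ, α ℓ) - (1 / 2) * ‖∑ ℓ, (α ℓ * y ℓ) • x ℓ‖ ^ 2)
    (αs : Fin m → ℝ) (hαs : αs ∈ A)
    (hmax : ∀ α ∈ A, f α ≤ f αs)
    (S : Set (Fin m)) (hS : S = {ℓ | 0 < αs ℓ})
    (F : Set (Fin m)) (hF : F ∩ S = ∅)
    (σ : Fin k → Fin m)
    (hσinj : Function.Injective σ) (hσrange : Set.range σ = Fᶜ)
    (g : (Fin k → ℝ) → ℝ)
    (hg : g = fun β => (∑ j, β j) - (1 / 2) * ‖∑ j, (β j * y (σ j)) • x (σ j)‖ ^ 2) :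
    ∀ β : Fin k → ℝ, (∀ j, 0 ≤ β j ∧ β j ≤ C) → (∑ j, β j * y (σ j) = 0) →
      (∀ β' : Fin k → ℝ, (∀ j, 0 ≤ β' j ∧ β' j ≤ C) → (∑ j, β' j * y (σ j) = 0) →
        g β' ≤ g β) →
      ∑ j, (β j * y (σ j)) • x (σ j) = ∑ ℓ, (αs ℓ * y ℓ) • x ℓ := by
  intro β hβ hβy hβmax
  subst hA hf hg hS
  have hzero : ∀ ℓ ∉ Set.range σ, αs ℓ = 0 := by
    intro ℓ hℓ
    rw [hσrange, Set.notMem_compl_iff] at hℓ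
    by_contra hne
    have hmem : ℓ ∈ F ∩ {ℓ | 0 < αs ℓ} := ⟨hℓ, lt_of_le_of_ne (hαs.1 ℓ).1 (Ne.symm hne)⟩
    simp [hF] at hmem
  have restrict : ∀ α : Fin m → ℝ, (∀ ℓ ∉ Set.range σ, α ℓ = 0) →
      ∑ j, α (σ j) = ∑ ℓ, α ℓ ∧ ∑ j, α (σ j) * y (σ j) = ∑ ℓ, α ℓ * y ℓ ∧
      ∑ j, (α (σ j) * y (σ j)) • x (σ j) = ∑ ℓ, (α ℓ * y ℓ) • x ℓ := by
    intro α hα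
    refine ⟨?_, ?_, ?_⟩ <;>
      exact Fintype.sum_of_injective σ hσinj _ _ (fun ℓ hℓ => by simp [hα ℓ hℓ]) fun _ => rfl
  obtain ⟨hs₁, hs₂, hs₃⟩ := restrict αs hzero
  let φ : (Fin k → ℝ) →ₗ[ℝ] ℝ := ∑ j, LinearMap.proj j
  let W : (Fin k → ℝ) →ₗ[ℝ] E := Fintype.linearCombination ℝ fun j => y (σ j) • x (σ j)
  have hφ : ∀ b, φ b = ∑ j, b j := fun b => by simp [φ]
  have hW : ∀ b, W b = ∑ j, (b j * y (σ j)) • x (σ j) := fun b => by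
    simp [W, Fintype.linearCombination_apply, smul_smul]
  rw [← hs₃, ← hW, ← hW fun j => αs (σ j)]
  refine eq_image_of_isMaxOn_sub_half_sq_norm φ W (convex_dual_feasible (fun j => y (σ j)) C)
    ⟨hβ, hβy⟩ ⟨fun j => hαs.1 (σ j), hs₂.trans hαs.2⟩ ?_ ?_
  · refine isMaxOn_iff.2 fun b hb => ?_
    simpa only [hφ, hW] using hβmax b hb.1 hb.2
  · refine isMaxOn_iff.2 fun b hb => ?_
    let b' : Fin m → ℝ := Function.extend σ b 0
    have hext : ∀ j, b' (σ j) = b j := hσinj.extend_apply b _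
    have hext₀ : ∀ ℓ ∉ Set.range σ, b' ℓ = 0 := fun ℓ hℓ =>
      Function.extend_apply' b _ ℓ hℓ
    obtain ⟨he₁, he₂, he₃⟩ := restrict b' hext₀
    simp only [hext] at he₁ he₂ he₃
    have hfeas : ∀ ℓ, 0 ≤ b' ℓ ∧ b' ℓ ≤ C := by
      intro ℓ
      by_cases hℓ : ℓ ∈ Set.range σ
      · obtain ⟨j, rfl⟩ := hℓ
        simpa only [hext] using hb.1 j
      · simpa only [hext₀ ℓ hℓ] using ⟨le_rfl, hC.le⟩
    have hle := hmax b' ⟨hfeas, he₂.symm.trans hb.2⟩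
    simpa only [hφ, hW, he₁, he₃, hs₁, hs₃] using hle
end
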